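/- arXiv:1208.0525 — 2 statements merged into one kernel-verified Lean document; each statement's English description precedes it below -/
import Mathlib

section
/- For every connected graph G on N vertices, the expected time for the asynchronous distributed binary consensus algorithm (with strong/weak opinion update rules) to reach consensus, starting from any initial assignment of strong positive and strong negative opinions with an odd number N of nodes, is O(N^4 log N); i.e., there is a universal constant c such that the expected convergence time is at most c·N^4·log N. -/
open Finset

/-- Pairwise update rule of the binary consensus algorithm on states in
`{S⁺ = 2, S⁻ = -2, W⁺ = 1, W⁻ = -1}`.  `upd a b = (a', b')` where `a` is the state of
the node whose clock ticked and `b` that of the chosen neighbor: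
equal states stay; opposite states `a = -b` become `(sign b, sign a)` (two opposite
strong opinions both turn weak); a stronger state meeting a weaker one of opposite sign
flips the weaker one's sign and they swap; a stronger and a weaker state of the same
sign swap. -/
def upd (a b : ℤ) : ℤ × ℤ :=
  if a = b then (a, b)
  else if a = -b then (b.sign, a.sign)
  else if |b| < |a| then (if a * b < 0 then (-b, a) else (b, a))
  else (if a * b < 0 then (b, -a) else (b, a))

/-- The configuration obtained from `σ` when the clock of node `i` ticks and it selects
its neighbor `j`. -/
def updConfig {N : ℕ} (σ : Fin N → ℤ) (i j : Fin N) : Fin N → ℤ :=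
  fun v => if v = i then (upd (σ i) (σ j)).1
    else if v = j then (upd (σ i) (σ j)).2
    else σ v

/-- Consensus: all node states have the same sign. -/
def Consensus {N : ℕ} (σ : Fin N → ℤ) : Prop :=
  (∀ v, 0 < σ v) ∨ (∀ v, σ v < 0)

/-- One step of the algorithm: some node `i` ticks and selects some neighbor `j`. -/
def StepRel (N : ℕ) (G : SimpleGraph (Fin N)) [DecidableRel G.Adj]
    (σ τ : Fin N → ℤ) : Prop :=
  ∃ i j, j ∈ G.neighborFinset i ∧ τ = updConfig σ i j

/-- `T` is the expected number of global clock ticks until consensus, as a function of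
the current configuration, characterized on all configurations reachable from `σ0` by
the first-step equations: at each tick node `i` is chosen with probability `1/N` and it
selects each neighbor `j` with probability `1/|N_i|`. -/
def IsConvergenceTime (N : ℕ) (G : SimpleGraph (Fin N)) [DecidableRel G.Adj]
    (σ0 : Fin N → ℤ) (T : (Fin N → ℤ) → ℝ) : Prop :=
  (∀ σ, Relation.ReflTransGen (StepRel N G) σ0 σ → Consensus σ → T σ = 0) ∧
  (∀ σ, Relation.ReflTransGen (StepRel N G) σ0 σ → ¬ Consensus σ →
    T σ = 1 + ∑ i : Fin N, ∑ j ∈ G.neighborFinset i,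
      (1 / ((N : ℝ) * (G.degree i : ℝ))) * T (updConfig σ i j))


lemma path_ineq {N : ℕ} (G : SimpleGraph (Fin N)) [DecidableRel G.Adj] (hG : G.Connected)
    (u : Fin N → ℝ) (a b : Fin N) :
    (u a - u b) ^ 2 ≤ N * ∑ i, ∑ j, if G.Adj i j then (u i - u j) ^ 2 else 0 := by
  classical
  obtain ⟨p, hp⟩ := hG.exists_isPath a b
  have h1 : ∀ {a b : Fin N} (p : G.Walk a b),
      u a - u b = (p.darts.map (fun d => u d.fst - u d.snd)).sum := by
    intro a b p
    induction p with
    | nil => simp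
    | cons h p ih => simp [← ih]
  have hnd : p.darts.Nodup := by
    have := hp.isTrail.edges_nodup
    exact List.Nodup.of_map _ this
  have h2 : u a - u b = ∑ d ∈ p.darts.toFinset, (u d.fst - u d.snd) := by
    rw [h1 p, List.sum_toFinset _ hnd]
  have hcard : (p.darts.toFinset.card : ℝ) ≤ N := by
    rw [List.toFinset_card_of_nodup hnd, SimpleGraph.Walk.length_darts]
    have := hp.length_lt
    simp at this
    exact_mod_cast this.le
  rw [h2]
  refine (sq_sum_le_card_mul_sum_sq).trans ?_
  have hnn : 0 ≤ ∑ d ∈ p.darts.toFinset, (u d.fst - u d.snd) ^ 2 :=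
    Finset.sum_nonneg fun _ _ => sq_nonneg _
  refine mul_le_mul hcard ?_ hnn (Nat.cast_nonneg _)
  rw [← Finset.sum_product']
  have himg : ∑ d ∈ p.darts.toFinset, (u d.fst - u d.snd) ^ 2
      = ∑ q ∈ p.darts.toFinset.image (fun d => d.toProd),
        (if G.Adj q.1 q.2 then (u q.1 - u q.2) ^ 2 else 0) := by
    rw [Finset.sum_image]
    · refine Finset.sum_congr rfl fun d _ => ?_
      rw [if_pos d.adj]
    · intro d _ e _ h
      exact SimpleGraph.Dart.ext _ _ h
  rw [himg]
  refine Finset.sum_le_sum_of_subset_of_nonneg (Finset.subset_univ _) ?_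
  intro q _ _
  split_ifs <;> positivity

/-- transition weights -/
noncomputable def wt {N : ℕ} (G : SimpleGraph (Fin N)) [DecidableRel G.Adj] (i j : Fin N) : ℝ :=
  if G.Adj i j then 1 / ((N : ℝ) * (G.degree i : ℝ)) else 0

lemma wt_nonneg {N : ℕ} (G : SimpleGraph (Fin N)) [DecidableRel G.Adj] (i j : Fin N) :
    0 ≤ wt G i j := by
  unfold wt; split_ifs <;> positivity

lemma wt_sum {N : ℕ} (G : SimpleGraph (Fin N)) [DecidableRel G.Adj] (X : Fin N → Fin N → ℝ) :
    ∑ i : Fin N, ∑ j ∈ G.neighborFinset i, (1 / ((N : ℝ) * (G.degree i : ℝ))) * X i j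
      = ∑ i, ∑ j, wt G i j * X i j := by
  refine Finset.sum_congr rfl fun i _ => ?_
  rw [SimpleGraph.neighborFinset_eq_filter, Finset.sum_filter]
  refine Finset.sum_congr rfl fun j _ => ?_
  unfold wt
  split_ifs <;> simp

lemma deg_pos {N : ℕ} (hN : 2 ≤ N) (G : SimpleGraph (Fin N)) [DecidableRel G.Adj]
    (hG : G.Connected) (i : Fin N) : 0 < G.degree i := by
  have : Nontrivial (Fin N) := Fin.nontrivial_iff_two_le.2 hN
  exact hG.preconnected.degree_pos_of_nontrivial i

lemma wt_total {N : ℕ} (hN : 2 ≤ N) (G : SimpleGraph (Fin N)) [DecidableRel G.Adj]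
    (hG : G.Connected) : ∑ i, ∑ j, wt G i j = 1 := by
  have := wt_sum G (fun _ _ => 1)
  simp only [mul_one] at this
  rw [← this]
  have hN0 : (N : ℝ) ≠ 0 := by positivity
  have : ∀ i : Fin N, ∑ j ∈ G.neighborFinset i, (1 / ((N : ℝ) * (G.degree i : ℝ))) = 1 / N := by
    intro i
    have h := deg_pos hN G hG i
    have h' : (G.degree i : ℝ) ≠ 0 := by positivity
    rw [Finset.sum_const, SimpleGraph.card_neighborFinset_eq_degree, nsmul_eq_mul]
    field_simp
  rw [Finset.sum_congr rfl fun i _ => this i]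
  simp [hN0]

lemma energy_ineq {N : ℕ} (hN : 2 ≤ N) (G : SimpleGraph (Fin N)) [DecidableRel G.Adj]
    (hG : G.Connected) (u : Fin N → ℝ) (a b : Fin N) :
    (u a - u b) ^ 2 ≤ (N : ℝ) ^ 3 * ∑ i, ∑ j, wt G i j * (u i - u j) ^ 2 := by
  refine (path_ineq G hG u a b).trans ?_
  rw [pow_succ' (N : ℝ) 2, mul_assoc]
  refine mul_le_mul_of_nonneg_left ?_ (Nat.cast_nonneg _)
  rw [Finset.mul_sum]
  refine Finset.sum_le_sum fun i _ => ?_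
  rw [Finset.mul_sum]
  refine Finset.sum_le_sum fun j _ => ?_
  unfold wt
  split_ifs with h
  · have hd : 0 < (G.degree i : ℝ) := by exact_mod_cast deg_pos hN G hG i
    have hN0 : (0 : ℝ) < N := by positivity
    have hd2 : (G.degree i : ℝ) ≤ N := by
      have := G.degree_lt_card_verts i
      simp at this
      exact_mod_cast this.le
    have : 1 ≤ (N : ℝ) ^ 2 * (1 / (N * G.degree i)) := by
      rw [mul_one_div, le_div_iff₀ (by positivity)]
      nlinarith
    nlinarith [sq_nonneg (u i - u j)]
  · simp

/-- There is a Green function. -/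
lemma exists_green {N : ℕ} (hN : 2 ≤ N) (G : SimpleGraph (Fin N)) [DecidableRel G.Adj]
    (hG : G.Connected) : ∃ Z : Fin N → Fin N → ℝ, (∀ x y, Z x y = Z y x) ∧
      (∀ x, ∑ y, Z x y = 1) ∧
      (∀ x y, ∑ j, (wt G x j + wt G j x) * (Z x y - Z j y) = (if x = y then 1 else 0) - 1 / N) := by
  classical
  have hN0 : (0 : ℝ) < N := by positivity
  let M : Matrix (Fin N) (Fin N) ℝ := fun i j =>
    (if i = j then ∑ k, (wt G i k + wt G k i) else 0) - (wt G i j + wt G j i) + 1 / N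
  have hM : ∀ (u : Fin N → ℝ) i, M.mulVec u i
      = ∑ j, (wt G i j + wt G j i) * (u i - u j) + (1 / N) * ∑ j, u j := by
    intro u i
    simp only [Matrix.mulVec, dotProduct, M, add_mul, sub_mul, Finset.sum_add_distrib,
      Finset.sum_sub_distrib, mul_sub, ite_mul, zero_mul, Finset.sum_ite_eq, Finset.mem_univ,
      if_true, Finset.sum_mul, Finset.mul_sum]
  have hE : ∀ u : Fin N → ℝ, ∑ i, u i * ∑ j, (wt G i j + wt G j i) * (u i - u j)
      = ∑ i, ∑ j, wt G i j * (u i - u j) ^ 2 := by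
    intro u
    have e1 : ∑ i, u i * ∑ j, (wt G i j + wt G j i) * (u i - u j)
      = ∑ i, ∑ j, wt G i j * (u i * (u i - u j)) + ∑ i, ∑ j, wt G j i * (u i * (u i - u j)) := by
      rw [← Finset.sum_add_distrib]
      refine Finset.sum_congr rfl fun i _ => ?_
      rw [← Finset.sum_add_distrib, Finset.mul_sum]
      refine Finset.sum_congr rfl fun j _ => ?_
      ring
    rw [e1, Finset.sum_comm (f := fun i j => wt G j i * (u i * (u i - u j))),
      ← Finset.sum_add_distrib]
    refine Finset.sum_congr rfl fun i _ => ?_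
    rw [← Finset.sum_add_distrib]
    refine Finset.sum_congr rfl fun j _ => ?_
    ring
  have hdet : M.det ≠ 0 := by
    intro h0
    obtain ⟨u, hu, hMu⟩ := Matrix.exists_mulVec_eq_zero_iff.2 h0
    have h1 : ∑ i, u i * M.mulVec u i = 0 := by simp [hMu]
    simp only [hM, mul_add, Finset.sum_add_distrib] at h1
    rw [hE, ← Finset.sum_mul] at h1
    have h2 : 0 ≤ ∑ i, ∑ j, wt G i j * (u i - u j) ^ 2 :=
      Finset.sum_nonneg fun i _ => Finset.sum_nonneg fun j _ =>
        mul_nonneg (wt_nonneg G i j) (sq_nonneg _)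
    have h3 : (∑ j, u j) * (1 / N * ∑ j, u j) = (1 / N) * (∑ j, u j) ^ 2 := by ring
    rw [h3] at h1
    have h4 : 0 ≤ (1 / (N : ℝ)) * (∑ j, u j) ^ 2 := by positivity
    have h5 : ∑ i, ∑ j, wt G i j * (u i - u j) ^ 2 = 0 := by linarith
    have h6 : (1 / (N : ℝ)) * (∑ j, u j) ^ 2 = 0 := by linarith
    have h7 : ∑ j, u j = 0 := by
      rcases mul_eq_zero.1 h6 with h | h
      · exfalso; have : (0 : ℝ) < 1 / N := by positivity
        linarith
      · exact pow_eq_zero_iff (two_ne_zero) |>.1 h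
    have h8 : ∀ a b, u a = u b := by
      intro a b
      have := energy_ineq hN G hG u a b
      rw [h5, mul_zero] at this
      have := pow_eq_zero_iff (two_ne_zero) |>.1 (le_antisymm this (sq_nonneg _))
      linarith
    apply hu
    funext a
    have : ∑ j, u j = N * u a := by
      rw [Finset.sum_congr rfl fun j _ => h8 j a]; simp
    rw [h7] at this
    have := this.symm
    simpa [hN0.ne'] using this
  have hunit : IsUnit M.det := isUnit_iff_ne_zero.2 hdet
  have hsymM : M.transpose = M := by
    ext i j
    rw [Matrix.transpose_apply]
    by_cases h : i = j
    · subst h; rfl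
    · simp only [M, if_neg h, if_neg (Ne.symm h)]; ring
  have hsym : ∀ x y, M⁻¹ x y = M⁻¹ y x := by
    intro x y
    have : (M⁻¹).transpose = M⁻¹ := by rw [Matrix.transpose_nonsing_inv, hsymM]
    exact congrFun (congrFun this y) x
  have hone : M.mulVec (fun _ => 1) = fun _ => 1 := by
    funext i
    rw [hM]
    simp [hN0.ne']
  have hsum : ∀ x, ∑ y, M⁻¹ x y = 1 := by
    intro x
    have : (M⁻¹).mulVec (fun _ => 1) = fun _ => 1 := by
      conv_lhs => rw [← hone]
      rw [Matrix.mulVec_mulVec, Matrix.nonsing_inv_mul _ hunit, Matrix.one_mulVec]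
    have := congrFun this x
    simpa [Matrix.mulVec, dotProduct] using this
  obtain ⟨Z, hZ⟩ : ∃ Z : Matrix (Fin N) (Fin N) ℝ, Z = M⁻¹ := ⟨_, rfl⟩
  rw [← hZ] at hsym hsum
  refine ⟨fun x y => Z x y, hsym, hsum, ?_⟩
  intro x y
  have hMZ : M * Z = 1 := by rw [hZ]; exact Matrix.mul_nonsing_inv _ hunit
  have h1 : M.mulVec (fun j => Z j y) x = if x = y then 1 else 0 := by
    have := congrFun (congrFun hMZ x) y
    rw [Matrix.one_apply] at this
    rw [← this]; rfl
  rw [hM] at h1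
  have h2 : ∑ j, Z j y = 1 := by
    rw [← hsum y]; exact Finset.sum_congr rfl fun j _ => hsym j y
  rw [h2] at h1
  linarith

lemma green_bound {N : ℕ} (hN : 2 ≤ N) (G : SimpleGraph (Fin N)) [DecidableRel G.Adj]
    (hG : G.Connected) (Z : Fin N → Fin N → ℝ) (hs : ∀ x y, Z x y = Z y x)
    (h1 : ∀ x, ∑ y, Z x y = 1)
    (hL : ∀ x y, ∑ j, (wt G x j + wt G j x) * (Z x y - Z j y)
      = (if x = y then 1 else 0) - 1 / N) (x y : Fin N) :
    |Z x y| ≤ (N : ℝ) ^ 3 + 1 := by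
  have hN0 : (0 : ℝ) < N := by positivity
  have h1' : ∑ i, Z i x = 1 := by
    rw [← h1 x]; exact Finset.sum_congr rfl fun j _ => hs j x
  have hE : ∑ i, ∑ j, wt G i j * (Z i x - Z j x) ^ 2 = Z x x - 1 / N := by
    have e1 : ∑ i, Z i x * ∑ j, (wt G i j + wt G j i) * (Z i x - Z j x)
      = ∑ i, ∑ j, wt G i j * (Z i x * (Z i x - Z j x))
        + ∑ i, ∑ j, wt G j i * (Z i x * (Z i x - Z j x)) := by
      rw [← Finset.sum_add_distrib]
      refine Finset.sum_congr rfl fun i _ => ?_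
      rw [← Finset.sum_add_distrib, Finset.mul_sum]
      refine Finset.sum_congr rfl fun j _ => ?_
      ring
    have e2 : ∑ i, Z i x * ∑ j, (wt G i j + wt G j i) * (Z i x - Z j x)
        = ∑ i, ∑ j, wt G i j * (Z i x - Z j x) ^ 2 := by
      rw [e1, Finset.sum_comm (f := fun i j => wt G j i * (Z i x * (Z i x - Z j x))),
        ← Finset.sum_add_distrib]
      refine Finset.sum_congr rfl fun i _ => ?_
      rw [← Finset.sum_add_distrib]
      refine Finset.sum_congr rfl fun j _ => ?_
      ring
    rw [← e2]
    rw [Finset.sum_congr rfl fun i _ => by rw [hL i x]]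
    simp only [mul_sub, Finset.sum_sub_distrib, mul_ite, mul_one, mul_zero,
      Finset.sum_ite_eq', Finset.mem_univ, if_true]
    rw [← Finset.sum_mul, h1', one_mul]
  set D := Z x x - 1 / N with hD
  have hD0 : 0 ≤ D := by
    rw [← hE]
    exact Finset.sum_nonneg fun i _ => Finset.sum_nonneg fun j _ =>
        mul_nonneg (wt_nonneg G i j) (sq_nonneg _)
  have hen : ∀ b, (Z x x - Z b x) ^ 2 ≤ (N : ℝ) ^ 3 * D := by
    intro b
    have := energy_ineq hN G hG (fun i => Z i x) x b
    rwa [hE] at this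
  obtain ⟨a, ha⟩ : ∃ a, Z a x ≤ 1 / N := by
    by_contra! h
    have : ∑ i : Fin N, (1 / (N : ℝ)) < ∑ i, Z i x :=
      Finset.sum_lt_sum_of_nonempty ⟨x, Finset.mem_univ _⟩ fun i _ => h i
    rw [h1'] at this
    simp [hN0.ne'] at this
  have hDa : D ≤ Z x x - Z a x := by linarith
  have hN3 : (0 : ℝ) < (N : ℝ) ^ 3 := by positivity
  have hDle : D ≤ (N : ℝ) ^ 3 := by
    by_contra! h
    have := hen a
    nlinarith
  have hy : |Z x x - Z y x| ≤ (N : ℝ) ^ 3 := by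
    apply abs_le_of_sq_le_sq _ hN3.le
    have := hen y
    nlinarith
  have hinv : 1 / (N : ℝ) ≤ 1 := by
    rw [div_le_one hN0]; exact_mod_cast (by omega : 1 ≤ N)
  have hinv0 : 0 < 1 / (N : ℝ) := by positivity
  rw [hs x y]
  rw [abs_le] at hy ⊢
  constructor
  · linarith [hy.2]
  · by_cases hq : Z y x ≤ 1 / N
    · linarith
    · push Not at hq
      -- compare with the green function at y
      have hen2 := energy_ineq hN G hG (fun i => Z i x) y a
      rw [hE] at hen2
      have : |Z y x - Z a x| ≤ (N : ℝ) ^ 3 := by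
        apply abs_le_of_sq_le_sq _ hN3.le
        nlinarith
      linarith [(abs_le.1 this).2]

/-- supersolution for pair meeting -/
lemma exists_pair {N : ℕ} (hN : 2 ≤ N) (G : SimpleGraph (Fin N)) [DecidableRel G.Adj]
    (hG : G.Connected) : ∃ f : Fin N → Fin N → ℝ,
      (∀ x y, 0 ≤ f x y) ∧ (∀ x y, f x y ≤ 8 * (N : ℝ) ^ 4) ∧
      ∀ x y, x ≠ y → ∑ i, ∑ j, wt G i j *
        (if (x = i ∧ y = j) ∨ (x = j ∧ y = i) then 0
          else f (Equiv.swap i j x) (Equiv.swap i j y)) ≤ f x y - 1 := by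
  obtain ⟨Z, hs, h1, hL⟩ := exists_green hN G hG
  have hb := green_bound hN G hG Z hs h1 hL
  have hN0 : (0 : ℝ) < N := by positivity
  have hN1 : (1 : ℝ) ≤ N := by exact_mod_cast (by omega : 1 ≤ N)
  set B : ℝ := N * ((N : ℝ) ^ 3 + 1) with hB
  have hbZ : ∀ x y, |N * Z x y| ≤ B := by
    intro x y
    rw [abs_mul, abs_of_pos hN0]
    exact mul_le_mul_of_nonneg_left (hb x y) hN0.le
  have hBle : 4 * B ≤ 8 * (N : ℝ) ^ 4 := by
    have : (N : ℝ) ≤ (N : ℝ) ^ 4 := le_self_pow₀ hN1 (by norm_num)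
    rw [hB]; nlinarith
  have hB0 : 0 ≤ B := by positivity
  have hb' : ∀ x y, -B ≤ N * Z x y ∧ N * Z x y ≤ B := fun x y => abs_le.1 (hbZ x y)
  refine ⟨fun x y => 3 * B - N * Z x y, ?_, ?_, ?_⟩
  · intro x y; have := hb' x y; linarith
  · intro x y; have := hb' x y; linarith
  intro x y hxy
  set f : Fin N → Fin N → ℝ := fun x y => 3 * B - N * Z x y with hf
  have htri : ∀ x y, f x y ≤ f x x + f y y := by
    intro x y
    have := hb' x y; have := hb' x x; have := hb' y y
    simp only [hf]; linarith
  have key : ∀ i j, wt G i j * (if (x = i ∧ y = j) ∨ (x = j ∧ y = i) then 0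
          else f (Equiv.swap i j x) (Equiv.swap i j y)) ≤
      wt G i j * f x y + ((if i = x then wt G i j * (f j y - f x y) else 0)
        + (if j = x then wt G i j * (f i y - f x y) else 0)
        + (if i = y then wt G i j * (f x j - f x y) else 0)
        + (if j = y then wt G i j * (f x i - f x y) else 0)) := by
    intro i j
    by_cases hadj : G.Adj i j
    swap
    · simp [wt, hadj]
    have hij : i ≠ j := hadj.ne
    have hw := wt_nonneg G i j
    by_cases hix : i = x
    · subst hix
      by_cases hjy : j = y
      · subst hjy
        have := mul_nonneg hw (sub_nonneg.2 (htri i j))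
        simp [hij, Ne.symm hij]
        linarith
      · have : Equiv.swap i j y = y :=
          Equiv.swap_apply_of_ne_of_ne (Ne.symm hxy) (Ne.symm hjy)
        simp [hjy, hij, Ne.symm hij, hxy, this, Ne.symm hjy]
        linarith
    · by_cases hjx : j = x
      · subst hjx
        by_cases hiy : i = y
        · subst hiy
          have := mul_nonneg hw (sub_nonneg.2 (htri j i))
          simp [hij, Ne.symm hij]
          linarith
        · have : Equiv.swap i j y = y :=
            Equiv.swap_apply_of_ne_of_ne (Ne.symm hiy) (Ne.symm hxy)
          simp [hiy, hij, Ne.symm hij, hxy, this, Ne.symm hiy]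
          linarith
      · have hx : Equiv.swap i j x = x :=
          Equiv.swap_apply_of_ne_of_ne (Ne.symm hix) (Ne.symm hjx)
        by_cases hiy : i = y
        · subst hiy
          simp [hx, hix, hjx, Ne.symm hix, Ne.symm hjx, hij, Ne.symm hij]
          linarith
        · by_cases hjy : j = y
          · subst hjy
            simp [hx, hix, hjx, Ne.symm hix, Ne.symm hjx, hij]
            linarith
          · have hy : Equiv.swap i j y = y :=
              Equiv.swap_apply_of_ne_of_ne (Ne.symm hiy) (Ne.symm hjy)
            simp [hx, hy, hix, hjx, hiy, hjy, Ne.symm hix, Ne.symm hjx]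
  refine (Finset.sum_le_sum fun i _ => Finset.sum_le_sum fun j _ => key i j).trans ?_
  simp only [Finset.sum_add_distrib]
  have t0 : ∑ i, ∑ j, wt G i j * f x y = f x y := by
    simp only [← Finset.sum_mul]
    rw [wt_total hN G hG, one_mul]
  have L1 : ∀ x y, x ≠ y → ∑ j, wt G x j * (f j y - f x y) + ∑ j, wt G j x * (f j y - f x y)
      = -1 := by
    intro x y hxy
    have := hL x y
    rw [if_neg hxy] at this
    rw [← Finset.sum_add_distrib]
    have e : ∀ j, wt G x j * (f j y - f x y) + wt G j x * (f j y - f x y)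
        = N * ((wt G x j + wt G j x) * (Z x y - Z j y)) := by
      intro j; simp only [hf]; ring
    rw [Finset.sum_congr rfl fun j _ => e j, ← Finset.mul_sum, this]
    field_simp
    ring
  have hfs : ∀ x y, f x y = f y x := by intro x y; simp only [hf, hs x y]
  have t1 : ∑ i, ∑ j, (if i = x then wt G i j * (f j y - f x y) else 0)
      = ∑ j, wt G x j * (f j y - f x y) := by
    rw [Finset.sum_comm]; simp
  have t2 : ∑ i, ∑ j, (if j = x then wt G i j * (f i y - f x y) else 0)
      = ∑ j, wt G j x * (f j y - f x y) := by
    simp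
  have t3 : ∑ i, ∑ j, (if i = y then wt G i j * (f x j - f x y) else 0)
      = ∑ j, wt G y j * (f j x - f y x) := by
    rw [Finset.sum_comm]
    simp only [Finset.sum_ite_eq', Finset.mem_univ, if_true]
    exact Finset.sum_congr rfl fun j _ => by rw [hfs x j, hfs x y]
  have t4 : ∑ i, ∑ j, (if j = y then wt G i j * (f x i - f x y) else 0)
      = ∑ j, wt G j y * (f j x - f y x) := by
    simp only [Finset.sum_ite_eq', Finset.mem_univ, if_true]
    exact Finset.sum_congr rfl fun j _ => by rw [hfs x j, hfs x y]
  rw [t0, t1, t2, t3, t4]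
  have := L1 x y hxy
  have := L1 y x (Ne.symm hxy)
  linarith

/-- weighted pair sum -/
noncomputable def pairSum {N : ℕ} (f : Fin N → Fin N → ℝ) (g : ℤ → ℤ → Bool)
    (σ : Fin N → ℤ) : ℝ := ∑ x, ∑ y, if g (σ x) (σ y) then f x y else 0

lemma pairSum_nonneg {N : ℕ} {f : Fin N → Fin N → ℝ} (hf0 : ∀ x y, 0 ≤ f x y)
    (g : ℤ → ℤ → Bool) (σ : Fin N → ℤ) : 0 ≤ pairSum f g σ := by
  refine Finset.sum_nonneg fun x _ => Finset.sum_nonneg fun y _ => ?_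
  split_ifs
  · exact hf0 x y
  · exact le_rfl

lemma pairSum_le_mul {N : ℕ} {f : Fin N → Fin N → ℝ} {H : ℝ} (hfH : ∀ x y, f x y ≤ H)
    (g : ℤ → ℤ → Bool) (σ : Fin N → ℤ) :
    pairSum f g σ ≤ pairSum (fun _ _ => 1) g σ * H := by
  unfold pairSum
  rw [Finset.sum_mul]
  refine Finset.sum_le_sum fun x _ => ?_
  rw [Finset.sum_mul]
  refine Finset.sum_le_sum fun y _ => ?_
  split_ifs
  · simpa using hfH x y
  · simp

lemma pairSum_one_le {N : ℕ} (g : ℤ → ℤ → Bool) (σ : Fin N → ℤ) :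
    pairSum (fun _ _ => 1) g σ ≤ (N : ℝ) ^ 2 := by
  have : pairSum (fun _ _ => 1) g σ ≤ ∑ x : Fin N, ∑ y : Fin N, (1 : ℝ) := by
    refine Finset.sum_le_sum fun x _ => Finset.sum_le_sum fun y _ => ?_
    split_ifs <;> norm_num
  refine this.trans (le_of_eq ?_)
  simp; ring

lemma one_le_pairSum {N : ℕ} (g : ℤ → ℤ → Bool) (σ : Fin N → ℤ) (x y : Fin N)
    (h : g (σ x) (σ y) = true) : 1 ≤ pairSum (fun _ _ => 1) g σ := by
  have nn : ∀ a b : Fin N, (0 : ℝ) ≤ if g (σ a) (σ b) then 1 else 0 := by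
    intro a b; split_ifs <;> norm_num
  refine le_trans ?_ (Finset.single_le_sum (s := univ) (f := fun a => ∑ b, if g (σ a) (σ b) then (1 : ℝ) else 0)
    (fun a _ => Finset.sum_nonneg fun b _ => nn a b) (Finset.mem_univ x))
  simpa [h] using (Finset.single_le_sum (s := univ) (f := fun b => if g (σ x) (σ b) then (1 : ℝ) else 0)
    (fun b _ => nn x b) (Finset.mem_univ y))

lemma pairSum_drift {N : ℕ} (G : SimpleGraph (Fin N)) [DecidableRel G.Adj]
    {f : Fin N → Fin N → ℝ} (hf0 : ∀ x y, 0 ≤ f x y)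
    (hf : ∀ x y, x ≠ y → ∑ i, ∑ j, wt G i j *
        (if (x = i ∧ y = j) ∨ (x = j ∧ y = i) then 0
          else f (Equiv.swap i j x) (Equiv.swap i j y)) ≤ f x y - 1)
    (g : ℤ → ℤ → Bool) (hg : ∀ a, g a a = false) (σ : Fin N → ℤ)
    (hstep : ∀ i j, i ≠ j → ∀ x y, g (updConfig σ i j x) (updConfig σ i j y) = true →
      g (σ (Equiv.swap i j x)) (σ (Equiv.swap i j y)) = true ∧
        ¬ ((x = i ∧ y = j) ∨ (x = j ∧ y = i))) :
    ∑ i, ∑ j, wt G i j * pairSum f g (updConfig σ i j)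
      ≤ pairSum f g σ - pairSum (fun _ _ => 1) g σ := by
  have step : ∀ i j, wt G i j * pairSum f g (updConfig σ i j) ≤
      ∑ x, ∑ y, if g (σ x) (σ y) then wt G i j *
        (if (x = i ∧ y = j) ∨ (x = j ∧ y = i) then 0
          else f (Equiv.swap i j x) (Equiv.swap i j y)) else 0 := by
    intro i j
    by_cases hadj : G.Adj i j
    swap
    · simp [wt, hadj]
    have hij := hadj.ne
    have e : ∑ x, ∑ y, (if g (σ x) (σ y) then wt G i j *
        (if (x = i ∧ y = j) ∨ (x = j ∧ y = i) then 0
          else f (Equiv.swap i j x) (Equiv.swap i j y)) else 0)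
        = ∑ x, ∑ y, (if g (σ (Equiv.swap i j x)) (σ (Equiv.swap i j y)) then wt G i j *
        (if (x = i ∧ y = j) ∨ (x = j ∧ y = i) then 0 else f x y) else 0) := by
      rw [← Equiv.sum_comp (Equiv.swap i j)]
      refine Finset.sum_congr rfl fun x _ => ?_
      rw [← Equiv.sum_comp (Equiv.swap i j)]
      refine Finset.sum_congr rfl fun y _ => ?_
      have hi : ∀ z, Equiv.swap i j z = i ↔ z = j := by
        intro z; rw [Equiv.swap_apply_eq_iff, Equiv.swap_apply_left]
      have hj : ∀ z, Equiv.swap i j z = j ↔ z = i := by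
        intro z; rw [Equiv.swap_apply_eq_iff, Equiv.swap_apply_right]
      simp only [Equiv.swap_apply_self, hi, hj]
      simp only [or_comm]
    rw [e]
    unfold pairSum
    rw [Finset.mul_sum]
    refine Finset.sum_le_sum fun x _ => ?_
    rw [Finset.mul_sum]
    refine Finset.sum_le_sum fun y _ => ?_
    by_cases h : g (updConfig σ i j x) (updConfig σ i j y) = true
    · obtain ⟨h1, h2⟩ := hstep i j hij x y h
      rw [if_pos h, if_pos h1, if_neg h2]
    · rw [if_neg h, mul_zero]
      split_ifs
      · simp
      · exact mul_nonneg (wt_nonneg G i j) (hf0 x y)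
      · exact le_rfl
  refine (Finset.sum_le_sum fun i _ => Finset.sum_le_sum fun j _ => step i j).trans ?_
  have sw : ∀ F : Fin N → Fin N → Fin N → Fin N → ℝ,
      ∑ i, ∑ j, ∑ x, ∑ y, F i j x y = ∑ x, ∑ y, ∑ i, ∑ j, F i j x y := by
    intro F
    calc ∑ i, ∑ j, ∑ x, ∑ y, F i j x y
        = ∑ i, ∑ x, ∑ j, ∑ y, F i j x y := Finset.sum_congr rfl fun i _ => Finset.sum_comm
      _ = ∑ x, ∑ i, ∑ j, ∑ y, F i j x y := Finset.sum_comm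
      _ = ∑ x, ∑ i, ∑ y, ∑ j, F i j x y := Finset.sum_congr rfl fun x _ =>
          Finset.sum_congr rfl fun i _ => Finset.sum_comm
      _ = ∑ x, ∑ y, ∑ i, ∑ j, F i j x y := Finset.sum_congr rfl fun x _ => Finset.sum_comm
  rw [sw]
  unfold pairSum
  rw [← Finset.sum_sub_distrib]
  refine Finset.sum_le_sum fun x _ => ?_
  rw [← Finset.sum_sub_distrib]
  refine Finset.sum_le_sum fun y _ => ?_
  by_cases h : g (σ x) (σ y) = true
  · simp only [if_pos h]
    apply hf x y
    rintro rfl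
    rw [hg] at h
    exact Bool.false_ne_true h
  · simp [if_neg h]

lemma log_drift {N : ℕ} (hN : 2 ≤ N) (G : SimpleGraph (Fin N)) [DecidableRel G.Adj]
    (hG : G.Connected) (S m H : ℝ) (S' : Fin N → Fin N → ℝ)
    (hS0 : 0 ≤ S) (hS0' : ∀ i j, 0 ≤ S' i j) (hm : 1 ≤ m) (hH : 1 ≤ H) (hSH : S ≤ m * H)
    (hd : ∑ i, ∑ j, wt G i j * S' i j ≤ S - m) :
    ∑ i, ∑ j, wt G i j * (2 * H * Real.log (1 + S' i j)) ≤ 2 * H * Real.log (1 + S) - 1 := by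
  have hp : 0 < 1 + S := by linarith
  have h1 : ∀ i j, wt G i j * (2 * H * Real.log (1 + S' i j)) ≤
      wt G i j * (2 * H * Real.log (1 + S)) + 2 * H / (1 + S) * (wt G i j * S' i j)
        - wt G i j * (2 * H / (1 + S) * S) := by
    intro i j
    have hp' : 0 < 1 + S' i j := by linarith [hS0' i j]
    have hl : Real.log (1 + S' i j) ≤ Real.log (1 + S) + (S' i j - S) / (1 + S) := by
      have := Real.log_le_sub_one_of_pos (div_pos hp' hp)
      rw [Real.log_div hp'.ne' hp.ne'] at this
      have e : (1 + S' i j) / (1 + S) - 1 = (S' i j - S) / (1 + S) := by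
        field_simp; ring
      linarith
    have := mul_le_mul_of_nonneg_left
      (mul_le_mul_of_nonneg_left hl (by linarith : 0 ≤ 2 * H)) (wt_nonneg G i j)
    refine this.trans (le_of_eq ?_)
    ring
  refine (Finset.sum_le_sum fun i _ => Finset.sum_le_sum fun j _ => h1 i j).trans ?_
  simp only [Finset.sum_add_distrib, Finset.sum_sub_distrib]
  simp only [← Finset.sum_mul, ← Finset.mul_sum]
  rw [wt_total hN G hG, one_mul, one_mul]
  have hc : 0 ≤ 2 * H / (1 + S) := by positivity
  have h2 := mul_le_mul_of_nonneg_left hd hc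
  have h3 : 1 ≤ 2 * H / (1 + S) * m := by
    rw [div_mul_eq_mul_div, le_div_iff₀ hp]
    nlinarith
  nlinarith

/-- allowed states -/
def okState (a : ℤ) : Prop := a = 2 ∨ a = -2 ∨ a = 1 ∨ a = -1

/-- strong charge -/
def chg (a : ℤ) : ℤ := if a = 2 then 1 else if a = -2 then -1 else 0

def g1 (a b : ℤ) : Bool := decide (a = 2 ∧ b = -2)

def g2 (a b : ℤ) : Bool := decide ((a = 2 ∧ b < 0) ∨ (a = -2 ∧ 0 < b))

lemma upd_ok {a b : ℤ} (ha : okState a) (hb : okState b) :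
    okState (upd a b).1 ∧ okState (upd a b).2 ∧
      chg (upd a b).1 + chg (upd a b).2 = chg a + chg b ∧
      ((upd a b).1 = 2 → b = 2) ∧ ((upd a b).1 = -2 → b = -2) ∧
      ((upd a b).2 = 2 → a = 2) ∧ ((upd a b).2 = -2 → a = -2) ∧
      ¬ ((upd a b).1 = 2 ∧ (upd a b).2 = -2) ∧ ¬ ((upd a b).1 = -2 ∧ (upd a b).2 = 2) ∧
      (a ≠ -2 → b ≠ -2 → ((upd a b).1 < 0 → b < 0) ∧ ((upd a b).2 < 0 → a < 0)
        ∧ ¬ ((upd a b).1 = 2 ∧ (upd a b).2 < 0) ∧ ¬ ((upd a b).2 = 2 ∧ (upd a b).1 < 0)) ∧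
      (a ≠ 2 → b ≠ 2 → (0 < (upd a b).1 → 0 < b) ∧ (0 < (upd a b).2 → 0 < a)
        ∧ ¬ ((upd a b).1 = -2 ∧ 0 < (upd a b).2) ∧ ¬ ((upd a b).2 = -2 ∧ 0 < (upd a b).1)) := by
  unfold okState at *
  rcases ha with rfl | rfl | rfl | rfl <;> rcases hb with rfl | rfl | rfl | rfl <;>
    refine ⟨?_, ?_, ?_, ?_, ?_, ?_, ?_, ?_, ?_, ?_, ?_⟩ <;> decide

lemma uc_left {N : ℕ} (σ : Fin N → ℤ) (i j : Fin N) :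
    updConfig σ i j i = (upd (σ i) (σ j)).1 := by simp [updConfig]

lemma uc_right {N : ℕ} (σ : Fin N → ℤ) {i j : Fin N} (h : i ≠ j) :
    updConfig σ i j j = (upd (σ i) (σ j)).2 := by simp [updConfig, Ne.symm h]

lemma uc_other {N : ℕ} (σ : Fin N → ℤ) {i j x : Fin N} (hxi : x ≠ i) (hxj : x ≠ j) :
    updConfig σ i j x = σ x := by simp [updConfig, hxi, hxj]

/-- invariant -/
def GoodCfg {N : ℕ} (σ : Fin N → ℤ) : Prop := (∀ v, okState (σ v)) ∧ Odd (∑ v, chg (σ v))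

/-- pull back a property along the swap -/
lemma uc_pull {N : ℕ} (σ : Fin N → ℤ) {i j : Fin N} (h : i ≠ j) (P : ℤ → Prop)
    (h1 : P (upd (σ i) (σ j)).1 → P (σ j)) (h2 : P (upd (σ i) (σ j)).2 → P (σ i)) (x : Fin N)
    (hx : P (updConfig σ i j x)) : P (σ (Equiv.swap i j x)) := by
  by_cases hxi : x = i
  · subst hxi
    rw [uc_left] at hx
    rw [Equiv.swap_apply_left]; exact h1 hx
  · by_cases hxj : x = j
    · subst hxj
      rw [uc_right σ h] at hx
      rw [Equiv.swap_apply_right]; exact h2 hx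
    · rw [uc_other σ hxi hxj] at hx
      rw [Equiv.swap_apply_of_ne_of_ne hxi hxj]; exact hx

lemma inv_step {N : ℕ} {σ : Fin N → ℤ} (hσ : GoodCfg σ) {i j : Fin N} (h : i ≠ j) :
    GoodCfg (updConfig σ i j) := by
  obtain ⟨h1, h2⟩ := hσ
  obtain ⟨o1, o2, oc, -⟩ := upd_ok (h1 i) (h1 j)
  refine ⟨?_, ?_⟩
  · intro v
    by_cases hi : v = i
    · subst hi; rw [uc_left]; exact o1
    · by_cases hj : v = j
      · subst hj; rw [uc_right σ h]; exact o2
      · rw [uc_other σ hi hj]; exact h1 v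
  · have : ∑ v, chg (updConfig σ i j v) = ∑ v, chg (σ v) := by
      have e : ∀ F : Fin N → ℤ, ∑ v, F v = F i + F j + ∑ v ∈ (univ.erase i).erase j, F v := by
        intro F
        rw [← Finset.add_sum_erase univ F (Finset.mem_univ i),
          ← Finset.add_sum_erase (univ.erase i) F (a := j) (by simp [Ne.symm h])]
        ring
      rw [e, e (fun v => chg (σ v)), uc_left, uc_right σ h, oc]
      congr 1
      refine Finset.sum_congr rfl fun v hv => ?_
      simp at hv
      rw [uc_other σ hv.2 hv.1]
    rw [this]; exact h2

lemma g1_step {N : ℕ} {σ : Fin N → ℤ} (hσ : GoodCfg σ) (i j : Fin N) (h : i ≠ j) (x y : Fin N)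
    (hg : g1 (updConfig σ i j x) (updConfig σ i j y) = true) :
    g1 (σ (Equiv.swap i j x)) (σ (Equiv.swap i j y)) = true ∧
        ¬ ((x = i ∧ y = j) ∨ (x = j ∧ y = i)) := by
  obtain ⟨-, -, -, p1, p2, p3, p4, p5, p6, -⟩ := upd_ok (hσ.1 i) (hσ.1 j)
  simp only [g1, decide_eq_true_eq] at hg ⊢
  refine ⟨⟨uc_pull σ h (fun z => z = 2) p1 p3 x hg.1, uc_pull σ h (fun z => z = -2) p2 p4 y hg.2⟩, ?_⟩
  rintro (⟨rfl, rfl⟩ | ⟨rfl, rfl⟩)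
  · rw [uc_left, uc_right σ h] at hg; exact p5 hg
  · rw [uc_left, uc_right σ h] at hg; exact p6 ⟨hg.2, hg.1⟩

lemma g2_step {N : ℕ} {σ : Fin N → ℤ} (hσ : GoodCfg σ)
    (hno : (∀ v, σ v ≠ 2) ∨ (∀ v, σ v ≠ -2)) (i j : Fin N) (h : i ≠ j) (x y : Fin N)
    (hg : g2 (updConfig σ i j x) (updConfig σ i j y) = true) :
    g2 (σ (Equiv.swap i j x)) (σ (Equiv.swap i j y)) = true ∧
        ¬ ((x = i ∧ y = j) ∨ (x = j ∧ y = i)) := by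
  obtain ⟨-, -, -, p1, p2, p3, p4, p5, p6, q1, q2⟩ := upd_ok (hσ.1 i) (hσ.1 j)
  simp only [g2, decide_eq_true_eq] at hg ⊢
  rcases hno with hno | hno
  · obtain ⟨r1, r2, r3, r4⟩ := q2 (hno i) (hno j)
    rcases hg with hg | hg
    · exact absurd (uc_pull σ h (fun z => z = 2) p1 p3 x hg.1) (hno _)
    · refine ⟨Or.inr ⟨uc_pull σ h (fun z => z = -2) p2 p4 x hg.1,
        uc_pull σ h (fun z => 0 < z) r1 r2 y hg.2⟩, ?_⟩
      rintro (⟨rfl, rfl⟩ | ⟨rfl, rfl⟩)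
      · rw [uc_left, uc_right σ h] at hg; exact r3 hg
      · rw [uc_left, uc_right σ h] at hg; exact r4 hg
  · obtain ⟨r1, r2, r3, r4⟩ := q1 (hno i) (hno j)
    rcases hg with hg | hg
    · refine ⟨Or.inl ⟨uc_pull σ h (fun z => z = 2) p1 p3 x hg.1,
        uc_pull σ h (fun z => z < 0) r1 r2 y hg.2⟩, ?_⟩
      rintro (⟨rfl, rfl⟩ | ⟨rfl, rfl⟩)
      · rw [uc_left, uc_right σ h] at hg; exact r3 hg
      · rw [uc_left, uc_right σ h] at hg; exact r4 hg
    · exact absurd (uc_pull σ h (fun z => z = -2) p2 p4 x hg.1) (hno _)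

/-- Two phases: both strong signs present. -/
def Both {N : ℕ} (σ : Fin N → ℤ) : Prop := ∃ x y, g1 (σ x) (σ y) = true

lemma not_both {N : ℕ} {σ : Fin N → ℤ} (h : ¬ Both σ) :
    (∀ v, σ v ≠ 2) ∨ (∀ v, σ v ≠ -2) := by
  by_contra! hc
  obtain ⟨⟨x, hx⟩, ⟨y, hy⟩⟩ := hc
  exact h ⟨x, y, by simp [g1, hx, hy]⟩

lemma both_step {N : ℕ} {σ : Fin N → ℤ} (hσ : GoodCfg σ) (h : ¬ Both σ) {i j : Fin N} (hij : i ≠ j) :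
    ¬ Both (updConfig σ i j) := by
  rintro ⟨x, y, hxy⟩
  exact h ⟨_, _, (g1_step hσ i j hij x y hxy).1⟩

lemma exists_g2 {N : ℕ} {σ : Fin N → ℤ} (hσ : GoodCfg σ) (hc : ¬ Consensus σ) :
    ∃ x y, g2 (σ x) (σ y) = true := by
  obtain ⟨x, hx⟩ : ∃ x, σ x = 2 ∨ σ x = -2 := by
    by_contra! h
    have : ∑ v, chg (σ v) = 0 := Finset.sum_eq_zero fun v _ => by
      simp [chg, (h v).1, (h v).2]
    have h2 := hσ.2
    rw [this] at h2
    exact absurd h2 (by decide)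
  have hnz : ∀ v, σ v ≠ 0 := by
    intro v hv
    have := hσ.1 v
    rw [hv] at this
    unfold okState at this
    omega
  unfold Consensus at hc
  push Not at hc
  obtain ⟨⟨a, ha⟩, ⟨b, hb⟩⟩ := hc
  have ha' : σ a < 0 := lt_of_le_of_ne ha (hnz a)
  have hb' : 0 < σ b := lt_of_le_of_ne hb (hnz b).symm
  rcases hx with hx | hx
  · exact ⟨x, a, by simp [g2, hx, ha']⟩
  · exact ⟨x, b, by simp [g2, hx, hb']⟩

open Classical in
/-- Lyapunov function -/
noncomputable def lyap {N : ℕ} (f : Fin N → Fin N → ℝ) (H : ℝ) (σ : Fin N → ℤ) : ℝ :=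
  if Both σ then 2 * H * Real.log (1 + pairSum f g1 σ) + 2 * H * Real.log (1 + (N : ℝ) ^ 2 * H)
  else 2 * H * Real.log (1 + pairSum f g2 σ)

lemma pairSum_le {N : ℕ} {f : Fin N → Fin N → ℝ} {H : ℝ} (hH : 1 ≤ H) (hfH : ∀ x y, f x y ≤ H)
    (g : ℤ → ℤ → Bool) (σ : Fin N → ℤ) : pairSum f g σ ≤ (N : ℝ) ^ 2 * H :=
  (pairSum_le_mul hfH g σ).trans (mul_le_mul_of_nonneg_right (pairSum_one_le g σ) (by linarith))

lemma log_pairSum {N : ℕ} {f : Fin N → Fin N → ℝ} {H : ℝ} (hH : 1 ≤ H)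
    (hf0 : ∀ x y, 0 ≤ f x y) (hfH : ∀ x y, f x y ≤ H)
    (g : ℤ → ℤ → Bool) (σ : Fin N → ℤ) : 0 ≤ 2 * H * Real.log (1 + pairSum f g σ) ∧
      2 * H * Real.log (1 + pairSum f g σ) ≤ 2 * H * Real.log (1 + (N : ℝ) ^ 2 * H) := by
  have h0 := pairSum_nonneg hf0 g σ
  have h1 := pairSum_le hH hfH g σ
  constructor
  · exact mul_nonneg (by linarith) (Real.log_nonneg (by linarith))
  · exact mul_le_mul_of_nonneg_left (Real.log_le_log (by linarith) (by linarith)) (by linarith)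

lemma lyap_bounds {N : ℕ} {f : Fin N → Fin N → ℝ} {H : ℝ} (hH : 1 ≤ H)
    (hf0 : ∀ x y, 0 ≤ f x y) (hfH : ∀ x y, f x y ≤ H) (σ : Fin N → ℤ) :
    0 ≤ lyap f H σ ∧ lyap f H σ ≤ 4 * H * Real.log (1 + (N : ℝ) ^ 2 * H) := by
  have h1 := log_pairSum hH hf0 hfH g1 σ
  have h2 := log_pairSum hH hf0 hfH g2 σ
  unfold lyap
  split_ifs <;> constructor <;> linarith [h1.1, h1.2, h2.1, h2.2]

lemma lyap_drift {N : ℕ} (hN : 2 ≤ N) (G : SimpleGraph (Fin N)) [DecidableRel G.Adj]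
    (hG : G.Connected) {f : Fin N → Fin N → ℝ} {H : ℝ} (hH : 1 ≤ H)
    (hf0 : ∀ x y, 0 ≤ f x y) (hfH : ∀ x y, f x y ≤ H)
    (hf : ∀ x y, x ≠ y → ∑ i, ∑ j, wt G i j *
        (if (x = i ∧ y = j) ∨ (x = j ∧ y = i) then 0
          else f (Equiv.swap i j x) (Equiv.swap i j y)) ≤ f x y - 1)
    {σ : Fin N → ℤ} (hσ : GoodCfg σ) (hc : ¬ Consensus σ) :
    ∑ i, ∑ j, wt G i j * lyap f H (updConfig σ i j) ≤ lyap f H σ - 1 := by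
  by_cases hb : Both σ
  · have hd := pairSum_drift G hf0 hf g1 (by intro a; simp [g1]; omega) σ (g1_step hσ)
    obtain ⟨x, y, hxy⟩ := hb
    have hl := log_drift hN G hG _ _ H (fun i j => pairSum f g1 (updConfig σ i j))
      (pairSum_nonneg hf0 g1 σ) (fun i j => pairSum_nonneg hf0 g1 _)
      (one_le_pairSum g1 σ x y hxy) hH (pairSum_le_mul hfH g1 σ) hd
    have hs : ∀ i j, wt G i j * lyap f H (updConfig σ i j) ≤
        wt G i j * (2 * H * Real.log (1 + pairSum f g1 (updConfig σ i j)))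
          + wt G i j * (2 * H * Real.log (1 + (N : ℝ) ^ 2 * H)) := by
      intro i j
      rw [← mul_add]
      refine mul_le_mul_of_nonneg_left ?_ (wt_nonneg G i j)
      have h1 := log_pairSum hH hf0 hfH g1 (updConfig σ i j)
      have h2 := log_pairSum hH hf0 hfH g2 (updConfig σ i j)
      unfold lyap
      split_ifs
      · exact le_rfl
      · linarith [h1.1, h2.2]
    refine (Finset.sum_le_sum fun i _ => Finset.sum_le_sum fun j _ => hs i j).trans ?_
    simp only [Finset.sum_add_distrib]
    simp only [← Finset.sum_mul]
    rw [wt_total hN G hG, one_mul]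
    have : lyap f H σ = 2 * H * Real.log (1 + pairSum f g1 σ)
        + 2 * H * Real.log (1 + (N : ℝ) ^ 2 * H) := by
      unfold lyap; rw [if_pos ⟨x, y, hxy⟩]
    rw [this]
    linarith
  · have hd := pairSum_drift G hf0 hf g2 (by intro a; simp [g2]; omega) σ
      (g2_step hσ (not_both hb))
    obtain ⟨x, y, hxy⟩ := exists_g2 hσ hc
    have hl := log_drift hN G hG _ _ H (fun i j => pairSum f g2 (updConfig σ i j))
      (pairSum_nonneg hf0 g2 σ) (fun i j => pairSum_nonneg hf0 g2 _)
      (one_le_pairSum g2 σ x y hxy) hH (pairSum_le_mul hfH g2 σ) hd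
    have this : lyap f H σ = 2 * H * Real.log (1 + pairSum f g2 σ) := by
      unfold lyap; rw [if_neg hb]
    rw [this]
    refine le_trans (Finset.sum_le_sum fun i _ => Finset.sum_le_sum fun j _ => ?_) hl
    by_cases hadj : G.Adj i j
    · unfold lyap
      rw [if_neg (both_step hσ hb hadj.ne)]
    · simp [wt, hadj]

lemma time_le {N : ℕ} (hN : 2 ≤ N) (G : SimpleGraph (Fin N)) [DecidableRel G.Adj]
    (hG : G.Connected) (σ0 : Fin N → ℤ) (h0 : GoodCfg σ0) (T V : (Fin N → ℤ) → ℝ)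
    (hT : IsConvergenceTime N G σ0 T) (hV0 : ∀ σ, 0 ≤ V σ)
    (hV : ∀ σ, GoodCfg σ → ¬ Consensus σ →
      ∑ i, ∑ j, wt G i j * V (updConfig σ i j) ≤ V σ - 1) : T σ0 ≤ 2 * V σ0 := by
  let R : Set (Fin N → ℤ) := {σ | Relation.ReflTransGen (StepRel N G) σ0 σ}
  have hinv : ∀ σ ∈ R, GoodCfg σ := by
    intro σ hσ
    induction hσ with
    | refl => exact h0
    | tail _ hs ih =>
      obtain ⟨i, j, hj, rfl⟩ := hs
      rw [SimpleGraph.mem_neighborFinset] at hj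
      exact inv_step ih hj.ne
  have hfin : R.Finite := by
    have : (Set.univ.pi fun _ : Fin N => ({2, -2, 1, -1} : Set ℤ)).Finite :=
      Set.Finite.pi fun _ => by simp
    refine this.subset ?_
    intro σ hσ v _
    have := (hinv σ hσ).1 v
    simpa [okState] using this
  have hne : R.Nonempty := ⟨σ0, Relation.ReflTransGen.refl⟩
  obtain ⟨σ, hσ, hmax⟩ := Set.exists_max_image R (fun σ => T σ - 2 * V σ) hfin hne
  have key : T σ - 2 * V σ ≤ 0 := by
    by_cases hc : Consensus σ
    · rw [hT.1 σ hσ hc]; linarith [hV0 σ]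
    · exfalso
      have e := hT.2 σ hσ hc
      rw [wt_sum G (fun i j => T (updConfig σ i j))] at e
      have d := hV σ (hinv σ hσ) hc
      have hle : ∑ i, ∑ j, wt G i j * T (updConfig σ i j) ≤
          ∑ i, ∑ j, (wt G i j * (T σ - 2 * V σ) + 2 * (wt G i j * V (updConfig σ i j))) := by
        refine Finset.sum_le_sum fun i _ => Finset.sum_le_sum fun j _ => ?_
        by_cases hadj : G.Adj i j
        · have hr : updConfig σ i j ∈ R := Relation.ReflTransGen.tail hσ
            ⟨i, j, by rw [SimpleGraph.mem_neighborFinset]; exact hadj, rfl⟩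
          have := mul_le_mul_of_nonneg_left (hmax _ hr) (wt_nonneg G i j)
          linarith
        · simp [wt, hadj]
      simp only [Finset.sum_add_distrib] at hle
      simp only [← Finset.sum_mul, ← Finset.mul_sum] at hle
      rw [wt_total hN G hG] at hle
      linarith
  have := hmax σ0 Relation.ReflTransGen.refl
  linarith

/-- There is a universal constant `c` such that for every connected graph
`G` on an odd number `N` of vertices and every initial assignment of strong positive
(`2`) and strong negative (`-2`) opinions, the expected convergence time of the
distributed binary consensus algorithm is at most `c·N^4·log N`. -/
theorem consensus_convergence_time_bound :
    ∃ c : ℝ, 0 < c ∧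
      ∀ (N : ℕ), Odd N →
        ∀ (G : SimpleGraph (Fin N)) [DecidableRel G.Adj], G.Connected →
          ∀ σ0 : Fin N → ℤ, (∀ v, σ0 v = 2 ∨ σ0 v = -2) →
            ∀ T : (Fin N → ℤ) → ℝ, IsConvergenceTime N G σ0 T →
              T σ0 ≤ c * (N : ℝ) ^ 4 * Real.log N := by
  refine ⟨512, by norm_num, ?_⟩
  intro N hodd G _ hG σ0 h0 T hT
  by_cases hN1 : N = 1
  · subst hN1
    have hc : Consensus σ0 := by
      rcases h0 0 with h | h
      · left; intro v; rw [Subsingleton.elim v 0, h]; norm_num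
      · right; intro v; rw [Subsingleton.elim v 0, h]; norm_num
    rw [hT.1 σ0 Relation.ReflTransGen.refl hc]
    simp
  have hN3 : 3 ≤ N := by
    obtain ⟨k, hk⟩ := hodd
    omega
  have hN : 2 ≤ N := by omega
  have hR3 : (3 : ℝ) ≤ N := by exact_mod_cast hN3
  have hinv : GoodCfg σ0 := by
    refine ⟨fun v => ?_, ?_⟩
    · rcases h0 v with h | h
      · left; exact h
      · right; left; exact h
    · have : ∀ v, Odd (chg (σ0 v)) := by
        intro v
        rcases h0 v with h | h <;> rw [h] <;> decide
      choose m hm using this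
      obtain ⟨k, hk⟩ := hodd
      refine ⟨∑ v, m v + k, ?_⟩
      rw [Finset.sum_congr rfl fun v _ => hm v, Finset.sum_add_distrib, ← Finset.mul_sum]
      simp only [Finset.sum_const, Finset.card_univ, Fintype.card_fin, nsmul_eq_mul, mul_one]
      have hk' : (N : ℤ) = 2 * (k : ℤ) + 1 := by exact_mod_cast hk
      linarith
  obtain ⟨f, hf0, hfH, hf⟩ := exists_pair hN G hG
  set H : ℝ := 8 * (N : ℝ) ^ 4 with hHdef
  have hp4 : (1 : ℝ) ≤ (N : ℝ) ^ 4 := one_le_pow₀ (by linarith)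
  have hH : 1 ≤ H := by linarith
  have h1 := time_le hN G hG σ0 hinv T (lyap f H) hT (fun σ => (lyap_bounds hH hf0 hfH σ).1)
    (fun σ hσ hc => lyap_drift hN G hG hH hf0 hfH hf hσ hc)
  have h2 := (lyap_bounds hH hf0 hfH σ0).2
  have h3 : Real.log (1 + (N : ℝ) ^ 2 * H) ≤ 8 * Real.log N := by
    have : (1 : ℝ) + (N : ℝ) ^ 2 * H ≤ (N : ℝ) ^ 8 := by
      have hp6 : (1 : ℝ) ≤ (N : ℝ) ^ 6 := one_le_pow₀ (by linarith)
      have e1 : (N : ℝ) ^ 2 * H = 8 * (N : ℝ) ^ 6 := by rw [hHdef]; ring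
      have e2 : (N : ℝ) ^ 8 = (N : ℝ) ^ 2 * (N : ℝ) ^ 6 := by ring
      have e3 : (9 : ℝ) ≤ (N : ℝ) ^ 2 := by nlinarith
      rw [e1, e2]
      nlinarith
    have hl := Real.log_le_log (by positivity) this
    rw [Real.log_pow] at hl
    exact_mod_cast hl
  have h4 := mul_le_mul_of_nonneg_left h3 (by linarith : 0 ≤ 4 * H)
  calc T σ0 ≤ 2 * (4 * H * (8 * Real.log N)) := by linarith
    _ = 512 * (N : ℝ) ^ 4 * Real.log N := by rw [hHdef]; ring
end

section
/- Let CT(G) be the maximum over starting vertices v of the expected time for a designated walker starting at v to have met each of the other walkers, all performing random walks on a connected graph G of N vertices with pairwise meeting times bounded by M(G) < N^4. Then CT(G) = O(N^4 log N): dividing time into ln N periods of length k·M(G), the probability the designated walker misses a fixed walker in one period is at most 1/k by Markov's inequality, so for k ≥ e^6, CT(G) ≤ k·M(G)·ln N + (1/2)·N^{6 − ln k} ≤ c·N^4·ln N for a universal constant c. -/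
open Finset

/-- `T` is the vector of expected times for the designated walker `a` to have met every
other walker, where one walker sits at each node of `G` (positions given by a
permutation `p`, walker `w` at node `p w`), and the dynamics are the asynchronous clock
dynamics: at each global clock tick a node `i` is chosen uniformly (probability `1/N`),
it picks a uniformly random neighbor `j` (probability `1/|N_i|`), and the occupants of
`i` and `j` swap; walker `a` meets walker `w` when the activated edge is the one joining
their current positions.  The state `(p, S)` records the positions `p` and the set `S`
of walkers already met by `a`; the process stops once `S` contains every walker `≠ a`. -/
def IsMeetAllTime (N : ℕ) (G : SimpleGraph (Fin N)) [DecidableRel G.Adj] (a : Fin N)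
    (T : Equiv.Perm (Fin N) × Finset (Fin N) → ℝ) : Prop :=
  (∀ p S, Finset.univ.erase a ⊆ S → T (p, S) = 0) ∧
  (∀ p S, ¬ Finset.univ.erase a ⊆ S →
    T (p, S) = 1 + ∑ i : Fin N, ∑ j ∈ G.neighborFinset i,
      (1 / ((N : ℝ) * (G.degree i : ℝ))) *
        T (Equiv.swap i j * p,
           S ∪ Finset.univ.filter
             (fun w => w ≠ a ∧ ((p w = i ∧ p a = j) ∨ (p w = j ∧ p a = i)))))

lemma aux_level {V : Type*} [Fintype V] [DecidableEq V] (P : V → V → ℝ)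
    (hs : ∀ i j, P i j = P j i) (hn : ∀ i j, 0 ≤ P i j) (h : V → ℝ) (c : ℝ) (hc : 0 ≤ c)
    (hA : ∀ A : Finset V, -c ≤ ∑ x ∈ A, ∑ j, P x j * (h j - h x)) (u v : V) :
    P u v * (h u - h v) ≤ c := by
  classical
  by_cases huv : h u ≤ h v
  · have := mul_nonneg (hn u v) (sub_nonneg.2 huv)
    nlinarith
  push Not at huv
  set A : Finset V := univ.filter (fun x => h u ≤ h x) with hAdef
  have hu : u ∈ A := by simp [A]
  have hv : v ∈ Aᶜ := by simp [A, huv]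
  have h1 := hA A
  have hsplit : ∑ x ∈ A, ∑ j, P x j * (h j - h x)
      = ∑ x ∈ A, ∑ j ∈ A, P x j * (h j - h x) + ∑ x ∈ A, ∑ j ∈ Aᶜ, P x j * (h j - h x) := by
    rw [← sum_add_distrib]
    exact sum_congr rfl fun x _ => (sum_add_sum_compl A _).symm
  have hzero : ∑ x ∈ A, ∑ j ∈ A, P x j * (h j - h x) = 0 := by
    have e1 : ∑ x ∈ A, ∑ j ∈ A, P x j * (h j - h x)
        = -∑ x ∈ A, ∑ j ∈ A, P x j * (h j - h x) := by
      conv_lhs => rw [sum_comm]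
      rw [← sum_neg_distrib]
      refine sum_congr rfl fun x _ => ?_
      rw [← sum_neg_distrib]
      refine sum_congr rfl fun j _ => ?_
      rw [hs j x]; ring
    linarith
  have hneg : ∀ x ∈ A, ∀ j ∈ Aᶜ, 0 ≤ P x j * (h x - h j) := by
    intro x hx j hj
    refine mul_nonneg (hn _ _) ?_
    simp [A] at hx hj
    linarith
  have h2 : P u v * (h u - h v) ≤ ∑ x ∈ A, ∑ j ∈ Aᶜ, P x j * (h x - h j) :=
    calc _ ≤ ∑ j ∈ Aᶜ, P u j * (h u - h j) :=
          single_le_sum (f := fun j => P u j * (h u - h j)) (hneg u hu) hv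
      _ ≤ _ := single_le_sum (f := fun x => ∑ j ∈ Aᶜ, P x j * (h x - h j))
          (fun x hx => sum_nonneg (hneg x hx)) hu
  have h3 : ∑ x ∈ A, ∑ j ∈ Aᶜ, P x j * (h x - h j)
      = -∑ x ∈ A, ∑ j ∈ Aᶜ, P x j * (h j - h x) := by
    rw [← sum_neg_distrib]
    refine sum_congr rfl fun x _ => ?_
    rw [← sum_neg_distrib]
    refine sum_congr rfl fun j _ => ?_
    ring
  linarith

lemma aux_walk {V : Type*} {G : SimpleGraph V} (h : V → ℝ) (K : ℝ)
    (hK : ∀ u v, G.Adj u v → h u - h v ≤ K) {u v : V} (w : G.Walk u v) :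
    h u - h v ≤ w.length * K := by
  induction w with
  | nil => simp
  | cons hadj p ih =>
    have := hK _ _ hadj
    simp only [SimpleGraph.Walk.length_cons]
    push_cast
    linarith

lemma aux_osc {N : ℕ} {G : SimpleGraph (Fin N)} (hG : G.Connected) (h : Fin N → ℝ) (K : ℝ)
    (hK0 : 0 ≤ K) (hK : ∀ u v, G.Adj u v → h u - h v ≤ K) (u v : Fin N) :
    h u - h v ≤ N * K := by
  obtain ⟨p, hp⟩ := (hG.preconnected u v).exists_isPath
  have h1 := aux_walk h K hK p
  have h2 := hp.length_lt
  simp at h2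
  have h3 : (p.length : ℝ) ≤ N := by exact_mod_cast h2.le
  nlinarith

/-- green function -/
lemma aux_green {N : ℕ} (hN : 2 ≤ N) {G : SimpleGraph (Fin N)} (hG : G.Connected)
    (P : Fin N → Fin N → ℝ)
    (hs : ∀ i j, P i j = P j i) (hn : ∀ i j, 0 ≤ P i j)
    (hP : ∀ i j, G.Adj i j → 2 / (N : ℝ) ^ 2 ≤ P i j) :
    ∃ g : Fin N → Fin N → ℝ, (∀ x y, g x y = g y x) ∧
      (∀ x y, ∑ j, P x j * (g j y - g x y) = 1 / N - if x = y then 1 else 0) ∧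
      (∀ x x' y, g x y - g x' y ≤ (N : ℝ) ^ 3 / 2) := by
  classical
  have hN0 : (0 : ℝ) < N := by positivity
  -- edge bound
  have key : ∀ (h : Fin N → ℝ) (c : ℝ), 0 ≤ c →
      (∀ A : Finset (Fin N), -c ≤ ∑ x ∈ A, ∑ j, P x j * (h j - h x)) →
      ∀ u v, h u - h v ≤ c * ((N : ℝ) ^ 3 / 2) := by
    intro h c hc hA u v
    have hK := aux_osc hG h (c * ((N : ℝ) ^ 2 / 2)) (by positivity) (by
      intro u v huv
      by_cases hh : h u - h v ≤ 0
      · exact hh.trans (by positivity)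
      push Not at hh
      have h1 := aux_level P hs hn h c hc hA u v
      have h2 := hP u v huv
      have h3 : 2 / (N : ℝ) ^ 2 * (h u - h v) ≤ c :=
        (mul_le_mul_of_nonneg_right h2 hh.le).trans h1
      rw [div_mul_eq_mul_div, div_le_iff₀ (by positivity)] at h3
      linarith) u v
    calc _ ≤ _ := hK
      _ = _ := by ring
  let d : Fin N → ℝ := fun x => ∑ j, P x j
  let B : Matrix (Fin N) (Fin N) ℝ :=
    Matrix.of fun x y => 1 - P x y + (if x = y then d x else 0)
  have hBsymm : B.transpose = B := by
    ext x y
    simp only [B, Matrix.transpose_apply, Matrix.of_apply, hs y x]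
    by_cases hxy : x = y
    · simp [hxy]
    · simp [hxy, Ne.symm hxy]
  have hBv : ∀ (v : Fin N → ℝ) (x : Fin N),
      ∑ j, B x j * v j = ∑ j, v j - ∑ j, P x j * (v j - v x) := by
    intro v x
    have : ∀ j, B x j * v j = v j - P x j * v j + (if x = j then d x * v j else 0) := by
      intro j; simp only [B, Matrix.of_apply]; split_ifs <;> ring
    simp only [this, sum_add_distrib, sum_sub_distrib, mul_sub, sum_ite_eq, mem_univ, if_true, d,
      sum_mul]
    ring
  have hLsum : ∀ v : Fin N → ℝ, ∑ x, ∑ j, P x j * (v j - v x) = 0 := by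
    intro v
    have e1 : ∑ x, ∑ j, P x j * (v j - v x)
        = -∑ x, ∑ j, P x j * (v j - v x) := by
      conv_lhs => rw [sum_comm]
      rw [← sum_neg_distrib]
      refine sum_congr rfl fun x _ => ?_
      rw [← sum_neg_distrib]
      refine sum_congr rfl fun j _ => ?_
      rw [hs j x]; ring
    linarith
  have hsumB : ∀ v : Fin N → ℝ, ∑ x, ∑ j, B x j * v j = N * ∑ j, v j := by
    intro v
    simp only [hBv, sum_sub_distrib, hLsum]
    simp
  have hdet : B.det ≠ 0 := by
    intro h0
    obtain ⟨v, hv0, hv⟩ := Matrix.exists_mulVec_eq_zero_iff.2 h0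
    have hv' : ∀ x, ∑ j, B x j * v j = 0 := fun x => congrFun hv x
    have hs0 : ∑ j, v j = 0 := by
      have := hsumB v
      simp only [hv', sum_const_zero] at this
      rcases mul_eq_zero.1 this.symm with h | h
      · exact absurd h hN0.ne'
      · exact h
    have hL : ∀ x, ∑ j, P x j * (v j - v x) = 0 := by
      intro x
      have := hBv v x
      rw [hv' x, hs0] at this
      linarith
    have hk := key v 0 le_rfl (by intro A; simp [hL])
    apply hv0
    funext x
    have hc : ∀ y, v y = v x := fun y => by
      have := hk x y; have := hk y x; linarith
    simp only [hc, sum_const, card_univ, Fintype.card_fin, nsmul_eq_mul] at hs0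
    rcases mul_eq_zero.1 hs0 with h | h
    · exact absurd h hN0.ne'
    · exact h
  have hBB : B * B⁻¹ = 1 := Matrix.mul_nonsing_inv B (isUnit_iff_ne_zero.2 hdet)
  have hgs : ∀ x y, B⁻¹ x y = B⁻¹ y x := by
    intro x y
    have : (B⁻¹).transpose = B⁻¹ := by rw [Matrix.transpose_nonsing_inv, hBsymm]
    exact (congrFun (congrFun this x) y).symm
  have hmul : ∀ x y, ∑ j, B x j * B⁻¹ j y = if x = y then 1 else 0 := by
    intro x y
    have := congrFun (congrFun hBB x) y
    rwa [Matrix.mul_apply, Matrix.one_apply] at this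
  have hcol : ∀ y, ∑ j, B⁻¹ j y = 1 / N := by
    intro y
    have := hsumB (fun j => B⁻¹ j y)
    simp only [hmul, sum_ite_eq', mem_univ, if_true] at this
    field_simp
    linarith
  have hL : ∀ x y, ∑ j, P x j * (B⁻¹ j y - B⁻¹ x y) = 1 / N - if x = y then 1 else 0 := by
    intro x y
    have := hBv (fun j => B⁻¹ j y) x
    simp only [hmul, hcol] at this
    linarith
  refine ⟨fun x y => B⁻¹ x y, hgs, hL, ?_⟩
  intro x x' y
  have := key (fun j => B⁻¹ j y) 1 zero_le_one (by
    intro A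
    simp only [hL, sum_sub_distrib, sum_const, sum_ite_eq']
    have : (0 : ℝ) ≤ A.card • (1 / (N : ℝ)) := by positivity
    split_ifs <;> linarith) x x'
  simpa using this

lemma aux_pair {N : ℕ} (hN : 2 ≤ N) {G : SimpleGraph (Fin N)} (hG : G.Connected)
    (q : Fin N → Fin N → ℝ) (hq0 : ∀ i j, 0 ≤ q i j) (hq1 : ∑ i, ∑ j, q i j = 1)
    (hqd : ∀ i, q i i = 0)
    (hqG : ∀ i j, G.Adj i j → 1 / (N : ℝ) ^ 2 ≤ q i j) :
    ∃ k : Fin N → Fin N → ℝ, (∀ x y, 1 ≤ k x y ∧ k x y ≤ 2) ∧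
      ∀ x y, x ≠ y →
        ∑ i, ∑ j, q i j * (if (x = i ∧ y = j) ∨ (x = j ∧ y = i) then 0 else
          k (Equiv.swap i j x) (Equiv.swap i j y)) ≤ (1 - 1 / (2 * (N : ℝ) ^ 4)) * k x y := by
  classical
  have hN0 : (0 : ℝ) < N := by positivity
  obtain ⟨g, gs, gL, go⟩ := aux_green hN hG (fun i j => q i j + q j i)
    (fun i j => add_comm _ _) (fun i j => add_nonneg (hq0 _ _) (hq0 _ _)) (by
      intro i j hij
      have h1 := hqG i j hij
      have h2 := hqG j i hij.symm
      have : 2 / (N : ℝ) ^ 2 = 1 / (N : ℝ) ^ 2 + 1 / (N : ℝ) ^ 2 := by ring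
      simp only [this]
      linarith)
  let z : Fin N := ⟨0, by omega⟩
  have hb : ∀ x y, |g x y - g z z| ≤ (N : ℝ) ^ 3 := by
    intro x y
    have h1 := go x z y
    have h2 := go z x y
    have h3 := go y z z
    have h4 := go z y z
    rw [gs y z] at h3 h4
    rw [abs_le]; constructor <;> linarith
  -- the function
  let k : Fin N → Fin N → ℝ := fun x y =>
    3 / 2 - (g x y - g z z) / (2 * (N : ℝ) ^ 3)
  have hk : ∀ x y, 1 ≤ k x y ∧ k x y ≤ 2 := by
    intro x y
    have h := abs_le.1 (hb x y)
    have h1 : (g x y - g z z) / (2 * (N : ℝ) ^ 3) ≤ 1 / 2 := by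
      rw [div_le_iff₀ (by positivity)]; linarith
    have h2 : -(1 / 2) ≤ (g x y - g z z) / (2 * (N : ℝ) ^ 3) := by
      rw [le_div_iff₀ (by positivity)]; linarith
    simp only [k]
    constructor <;> linarith
  have ks : ∀ x y, k x y = k y x := by intro x y; simp only [k, gs x y]
  have kL : ∀ x y, x ≠ y →
      ∑ j, (q x j + q j x) * (k j y - k x y) = - (1 / (2 * (N : ℝ) ^ 4)) := by
    intro x y hxy
    have h := gL x y
    rw [if_neg hxy] at h
    have : ∀ j, (q x j + q j x) * (k j y - k x y)
        = ((q x j + q j x) * (g j y - g x y)) * (-1 / (2 * (N : ℝ) ^ 3)) := by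
      intro j; simp only [k]; ring
    simp only [this, ← sum_mul, h]
    field_simp
    ring
  refine ⟨k, hk, ?_⟩
  intro x y hxy
  have hpt : ∀ i j, q i j * (if (x = i ∧ y = j) ∨ (x = j ∧ y = i) then 0 else
          k (Equiv.swap i j x) (Equiv.swap i j y)) ≤ q i j * k x y +
          ((if x = i then q i j * (k j y - k x y) else 0)
          + (if x = j then q i j * (k i y - k x y) else 0)
          + (if y = i then q i j * (k j x - k y x) else 0)
          + (if y = j then q i j * (k i x - k y x) else 0)) := by
    intro i j
    by_cases hij : i = j
    · subst hij; simp [hqd]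
    have h0 := hq0 i j
    have a1 := hk x x
    have a2 := hk y y
    have a3 := hk x y
    have a4 := ks x y
    by_cases h1 : x = i
    · subst h1
      by_cases h2 : y = j
      · subst h2
        simp [hxy, Ne.symm hxy, hij]
        nlinarith
      · have h3 : ¬ y = x := Ne.symm hxy
        simp [hxy, h2, h3, hij, Equiv.swap_apply_of_ne_of_ne h3 h2]
        linarith
    · by_cases h2 : x = j
      · subst h2
        by_cases h3 : y = i
        · subst h3
          simp [hxy, Ne.symm hxy]
          nlinarith
        · have h4 : ¬ y = x := Ne.symm hxy
          simp [h1, h3, h4, Equiv.swap_apply_of_ne_of_ne h3 h4]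
          linarith
      · by_cases h3 : y = i
        · subst h3
          simp [h1, h2, hij, Equiv.swap_apply_of_ne_of_ne h1 h2]
          rw [ks x j, ← ks x y]
          rw [ks j x]
          linarith
        · by_cases h4 : y = j
          · subst h4
            simp [h1, h2, h3, Equiv.swap_apply_of_ne_of_ne h1 h2]
            rw [ks x i, ← ks x y]
            linarith
          · simp [h1, h2, h3, h4, Equiv.swap_apply_of_ne_of_ne h1 h2,
              Equiv.swap_apply_of_ne_of_ne h3 h4]
  have hsum := sum_le_sum fun i (_ : i ∈ univ) => sum_le_sum fun j (_ : j ∈ univ) => hpt i j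
  refine hsum.trans ?_
  have e1 : ∀ x y, ∑ i, ∑ j, (if x = i then q i j * (k j y - k x y) else 0)
      = ∑ j, q x j * (k j y - k x y) := by
    intro x y
    rw [sum_comm]
    simp
  have e2 : ∀ x y, ∑ i, ∑ j, (if x = j then q i j * (k i y - k x y) else 0)
      = ∑ j, q j x * (k j y - k x y) := by
    intro x y
    simp
  have b1 := kL x y hxy
  have b2 := kL y x hxy.symm
  simp only [add_mul, sum_add_distrib] at b1 b2
  simp only [sum_add_distrib]
  rw [e1 x y, e2 x y, e1 y x, e2 y x]
  simp only [← sum_mul, hq1]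
  have a3 := hk x y
  have hd : (0 : ℝ) ≤ 1 / (2 * (N : ℝ) ^ 4) := by positivity
  nlinarith

lemma aux_compare {N : ℕ} {X : Type*} [Finite X] [Nonempty X]
    (q : Fin N → Fin N → ℝ) (hq0 : ∀ i j, 0 ≤ q i j) (hq1 : ∑ i, ∑ j, q i j = 1)
    (nxt : X → Fin N → Fin N → X) (done : X → Prop) (T W : X → ℝ)
    (hT0 : ∀ s, done s → T s = 0) (hW0 : ∀ s, done s → 0 ≤ W s)
    (hT : ∀ s, ¬ done s → T s = 1 + ∑ i, ∑ j, q i j * T (nxt s i j))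
    (hW : ∀ s, ¬ done s → 1 + ∑ i, ∑ j, q i j * W (nxt s i j) ≤ W s) (s : X) :
    T s ≤ 2 * W s := by
  obtain ⟨m, hm⟩ := Finite.exists_max (fun s => T s - 2 * W s)
  have hd : done m := by
    by_contra hd
    have h1 := hT m hd
    have h2 := hW m hd
    have h3 : ∑ i, ∑ j, q i j * (T (nxt m i j) - 2 * W (nxt m i j)) ≤
        ∑ i, ∑ j, q i j * (T m - 2 * W m) :=
      sum_le_sum fun i _ => sum_le_sum fun j _ => mul_le_mul_of_nonneg_left (hm _) (hq0 i j)
    simp only [← sum_mul, hq1] at h3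
    have h4 : ∑ i, ∑ j, q i j * (T (nxt m i j) - 2 * W (nxt m i j)) =
        ∑ i, ∑ j, q i j * T (nxt m i j) - 2 * ∑ i, ∑ j, q i j * W (nxt m i j) := by
      simp only [mul_sub, sum_sub_distrib, mul_sum]
      congr 1
      refine sum_congr rfl fun i _ => sum_congr rfl fun j _ => ?_
      ring
    linarith
  have := hm s
  have h1 := hT0 m hd
  have h2 := hW0 m hd
  linarith

/-- Let `CT(G)` be the maximum over starting configurations of the
expected time for a designated walker to have met each of the other walkers, all
performing random walks on a connected graph `G` of `N` vertices.  Then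
`CT(G) = O(N^4 log N)`: there is a universal constant `c` such that for every connected
graph `G` on `N` vertices, every designated walker `a`, every initial configuration of
positions and every solution `T` of the first-step equations,
`T(p, ∅) ≤ c·N^4·log N`. -/
theorem meet_all_walkers_time_bound :
    ∃ c : ℝ, 0 < c ∧
      ∀ (N : ℕ), 2 ≤ N →
        ∀ (G : SimpleGraph (Fin N)) [DecidableRel G.Adj], G.Connected →
          ∀ (a : Fin N) (T : Equiv.Perm (Fin N) × Finset (Fin N) → ℝ),
            IsMeetAllTime N G a T →
              ∀ p : Equiv.Perm (Fin N), T (p, ∅) ≤ c * (N : ℝ) ^ 4 * Real.log N := by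
  refine ⟨16, by norm_num, ?_⟩
  intro N hN G _ hG a T hT p
  classical
  have hN0 : (0 : ℝ) < N := by positivity
  have : Nontrivial (Fin N) := Fin.nontrivial_iff_two_le.2 hN
  have hdeg : ∀ i, 0 < G.degree i := fun i => hG.preconnected.degree_pos_of_nontrivial i
  let q : Fin N → Fin N → ℝ := fun i j =>
    if G.Adj i j then 1 / ((N : ℝ) * (G.degree i : ℝ)) else 0
  have hqsum : ∀ (i : Fin N) (f : Fin N → ℝ), ∑ j ∈ G.neighborFinset i,
      (1 / ((N : ℝ) * (G.degree i : ℝ))) * f j = ∑ j, q i j * f j := by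
    intro i f
    have : G.neighborFinset i = univ.filter (fun j => G.Adj i j) := by ext j; simp
    rw [this, sum_filter]
    refine sum_congr rfl fun j _ => ?_
    simp only [q]; split_ifs <;> simp
  have hq0 : ∀ i j, 0 ≤ q i j := by
    intro i j; simp only [q]; split_ifs <;> positivity
  have hq1 : ∑ i, ∑ j, q i j = 1 := by
    have : ∀ i, ∑ j, q i j = 1 / N := by
      intro i
      have h := hqsum i (fun _ => 1)
      simp only [mul_one] at h
      rw [← h]
      have : (G.degree i : ℝ) ≠ 0 := by exact_mod_cast (hdeg i).ne'
      simp only [sum_const, SimpleGraph.card_neighborFinset_eq_degree, nsmul_eq_mul]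
      field_simp
    simp [this, hN0.ne']
  have hqd : ∀ i, q i i = 0 := by intro i; simp [q]
  have hqG : ∀ i j, G.Adj i j → 1 / (N : ℝ) ^ 2 ≤ q i j := by
    intro i j hij
    simp only [q, if_pos hij]
    have h1 : (0 : ℝ) < G.degree i := by exact_mod_cast hdeg i
    have h2 : (G.degree i : ℝ) ≤ N := by
      have := (G.degree_lt_card_verts i).le
      simp at this
      exact_mod_cast this
    apply one_div_le_one_div_of_le (by positivity)
    nlinarith
  obtain ⟨k, hk, hkd⟩ := aux_pair hN hG q hq0 hq1 hqd hqG
  let met : Equiv.Perm (Fin N) → Fin N → Fin N → Finset (Fin N) := fun p i j =>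
    univ.filter (fun w => w ≠ a ∧ ((p w = i ∧ p a = j) ∨ (p w = j ∧ p a = i)))
  let R : Finset (Fin N) → Finset (Fin N) := fun S => (univ.erase a) \ S
  let g : Equiv.Perm (Fin N) × Finset (Fin N) → ℝ := fun s =>
    ∑ w ∈ R s.2, k (s.1 w) (s.1 a)
  let done : Equiv.Perm (Fin N) × Finset (Fin N) → Prop := fun s => univ.erase a ⊆ s.2
  let nxt : Equiv.Perm (Fin N) × Finset (Fin N) → Fin N → Fin N →
      Equiv.Perm (Fin N) × Finset (Fin N) := fun s i j =>
    (Equiv.swap i j * s.1, s.2 ∪ met s.1 i j)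
  let C : ℝ := 2 * (N : ℝ) ^ 4
  have hC : 0 < C := by positivity
  let W : Equiv.Perm (Fin N) × Finset (Fin N) → ℝ := fun s =>
    if done s then 0 else C * (1 + Real.log (g s))
  have hg0 : ∀ s, 0 ≤ g s := fun s => sum_nonneg fun w _ => by linarith [(hk (s.1 w) (s.1 a)).1]
  have hg1 : ∀ s, ¬ done s → 1 ≤ g s := by
    intro s hs
    obtain ⟨w, hw, hw'⟩ := not_subset.1 hs
    have hm : w ∈ R s.2 := mem_sdiff.2 ⟨hw, hw'⟩
    calc (1 : ℝ) ≤ k (s.1 w) (s.1 a) := (hk _ _).1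
      _ ≤ _ := single_le_sum (f := fun w => k (s.1 w) (s.1 a))
          (fun w _ => by linarith [(hk (s.1 w) (s.1 a)).1]) hm
  have hgN : ∀ s, g s ≤ 2 * N := by
    intro s
    calc g s ≤ ∑ w ∈ R s.2, (2 : ℝ) := sum_le_sum fun w _ => (hk _ _).2
      _ = (R s.2).card * 2 := by simp
      _ ≤ N * 2 := by
        have : (R s.2).card ≤ N := by simpa using card_le_univ (R s.2)
        have : ((R s.2).card : ℝ) ≤ N := by exact_mod_cast this
        linarith
      _ = _ := by ring
  -- drift of g
  have hgd : ∀ s, ∑ i, ∑ j, q i j * g (nxt s i j) ≤ (1 - 1 / C) * g s := by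
    intro s
    have h1 : ∀ i j, g (nxt s i j) = ∑ w ∈ R s.2,
        (if (s.1 w = i ∧ s.1 a = j) ∨ (s.1 w = j ∧ s.1 a = i) then 0 else
          k (Equiv.swap i j (s.1 w)) (Equiv.swap i j (s.1 a))) := by
      intro i j
      have hR : R (nxt s i j).2 = (R s.2).filter
          (fun w => ¬ ((s.1 w = i ∧ s.1 a = j) ∨ (s.1 w = j ∧ s.1 a = i))) := by
        ext w
        simp only [R, nxt, met, mem_sdiff, mem_union, mem_filter, mem_univ, mem_erase]
        tauto
      simp only [g]
      rw [hR, sum_filter]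
      refine sum_congr rfl fun w _ => ?_
      simp only [ite_not, nxt, Equiv.Perm.mul_apply]
    calc ∑ i, ∑ j, q i j * g (nxt s i j)
        = ∑ w ∈ R s.2, ∑ i, ∑ j, q i j *
          (if (s.1 w = i ∧ s.1 a = j) ∨ (s.1 w = j ∧ s.1 a = i) then 0 else
          k (Equiv.swap i j (s.1 w)) (Equiv.swap i j (s.1 a))) := by
          simp only [h1, mul_sum]
          rw [sum_comm' (s := R s.2) (t := fun _ => univ) (t' := univ) (s' := fun _ => R s.2)
            (by simp)]
          refine sum_congr rfl fun i _ => ?_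
          rw [sum_comm]
      _ ≤ ∑ w ∈ R s.2, (1 - 1 / C) * k (s.1 w) (s.1 a) := by
          refine sum_le_sum fun w hw => hkd _ _ ?_
          have : w ≠ a := (mem_erase.1 (mem_sdiff.1 hw).1).1
          exact fun h => this (s.1.injective h)
      _ = _ := by rw [← mul_sum]
  have hW : ∀ s, ¬ done s → 1 + ∑ i, ∑ j, q i j * W (nxt s i j) ≤ W s := by
    intro s hs
    have hgs := hg1 s hs
    have hgp : 0 < g s := by linarith
    have hlog : 0 ≤ Real.log (g s) := Real.log_nonneg hgs
    have hpt : ∀ s', W s' ≤ C * Real.log (g s) + C / g s * g s' := by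
      intro s'
      by_cases hd : done s'
      · simp only [W, if_pos hd]
        have := hg0 s'
        positivity
      · simp only [W, if_neg hd]
        have hgs' := hg1 s' hd
        have h1 := Real.log_le_sub_one_of_pos (show 0 < g s' / g s by positivity)
        rw [Real.log_div (by linarith) hgp.ne'] at h1
        have : C / g s * g s' = C * (g s' / g s) := by ring
        rw [this, ← mul_add]
        exact mul_le_mul_of_nonneg_left (by linarith) hC.le
    have h2 : ∑ i, ∑ j, q i j * W (nxt s i j) ≤
        ∑ i, ∑ j, q i j * (C * Real.log (g s) + C / g s * g (nxt s i j)) :=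
      sum_le_sum fun i _ => sum_le_sum fun j _ => mul_le_mul_of_nonneg_left (hpt _) (hq0 i j)
    have h3 : ∑ i, ∑ j, q i j * (C * Real.log (g s) + C / g s * g (nxt s i j))
        = C * Real.log (g s) + C / g s * ∑ i, ∑ j, q i j * g (nxt s i j) := by
      simp only [mul_add, sum_add_distrib, ← sum_mul, hq1, mul_sum]
      rw [one_mul]
      congr 1
      refine sum_congr rfl fun i _ => sum_congr rfl fun j _ => ?_
      ring
    have h4 : C / g s * ∑ i, ∑ j, q i j * g (nxt s i j) ≤ C / g s * ((1 - 1 / C) * g s) :=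
      mul_le_mul_of_nonneg_left (hgd s) (by positivity)
    have h5 : C / g s * ((1 - 1 / C) * g s) = C - 1 := by field_simp
    simp only [W, if_neg hs]
    linarith
  have hmain := aux_compare q hq0 hq1 nxt done T W (fun s hs => hT.1 s.1 s.2 hs)
    (fun s hs => by simp [W, hs]) (by
      intro s hs
      rw [show T s = T (s.1, s.2) from rfl, hT.2 s.1 s.2 hs]
      congr 1
      refine sum_congr rfl fun i _ => ?_
      rw [hqsum i]) hW (p, ∅)
  refine hmain.trans ?_
  have hl2 : (0.69 : ℝ) < Real.log 2 := by have := Real.log_two_gt_d9; linarith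
  have hlN : Real.log 2 ≤ Real.log N :=
    Real.log_le_log (by norm_num) (by exact_mod_cast hN)
  have hWle : W (p, ∅) ≤ C * (4 * Real.log N) := by
    by_cases hd : done (p, ∅)
    · simp only [W, if_pos hd]
      have : 0 ≤ Real.log N := by linarith
      positivity
    · simp only [W, if_neg hd]
      refine mul_le_mul_of_nonneg_left ?_ hC.le
      have h1 : Real.log (g (p, ∅)) ≤ Real.log (2 * N) :=
        Real.log_le_log (by linarith [hg1 _ hd]) (hgN _)
      rw [Real.log_mul (by norm_num) hN0.ne'] at h1
      linarith
  calc 2 * W (p, ∅) ≤ 2 * (C * (4 * Real.log N)) := by linarith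
    _ = _ := by simp only [C]; ring
end
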